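/- Let V : ℝ³ → ℝ be measurable, λ > 0, and δ > 0, and suppose that (1/(4π)²) ∬_{ℝ³×ℝ³} |V(x)| |V(y)| e^{−2√λ |x−y|} / |x−y|² dx dy ≤ δ². Then for every smooth compactly supported φ : ℝ³ → ℂ, |∫_{ℝ³} V(x) |φ(x)|² dx| ≤ δ (∫_{ℝ³} |∇φ(x)|² dx + λ ∫_{ℝ³} |φ(x)|² dx). Consequently, a Rollnik potential is infinitesimally form-bounded with respect to −Δ. -/

import Mathlib

open MeasureTheory Real Filter Topology
open scoped ENNReal

noncomputable section

abbrev E3 := EuclideanSpace ℝ (Fin 3)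

def sE (ε : ℝ) (x : E3) : ℝ := √(‖x‖ ^ 2 + ε ^ 2)

lemma sE_sq (ε : ℝ) (x : E3) : sE ε x ^ 2 = ‖x‖ ^ 2 + ε ^ 2 := Real.sq_sqrt (by positivity)
lemma sE_ge {ε : ℝ} (x : E3) : ε ≤ sE ε x := Real.le_sqrt_of_sq_le (by nlinarith [sq_nonneg ‖x‖])
lemma sE_pos {ε : ℝ} (hε : 0 < ε) (x : E3) : 0 < sE ε x := lt_of_lt_of_le hε (sE_ge x)
lemma sE_norm (ε : ℝ) (x : E3) : ‖x‖ ≤ sE ε x := Real.le_sqrt_of_sq_le (by nlinarith [sq_nonneg ε])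
lemma sE_cont (ε : ℝ) : Continuous (sE ε) := by unfold sE; fun_prop

def ei (i : Fin 3) : E3 := EuclideanSpace.single i 1

def g0 (k ε : ℝ) (x : E3) : ℝ := exp (-k * sE ε x) / sE ε x
def g1 (k ε : ℝ) (i : Fin 3) (x : E3) : ℝ :=
  - x i * (exp (-k * sE ε x) * (k * sE ε x + 1) / sE ε x ^ 3)
def g2 (k ε : ℝ) (i : Fin 3) (x : E3) : ℝ :=
  - (exp (-k * sE ε x) * (k * sE ε x + 1) / sE ε x ^ 3)
  + x i ^ 2 * (exp (-k * sE ε x) * (k^2 * sE ε x ^ 2 + 3 * k * sE ε x + 3) / sE ε x ^ 5)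
def rho (k ε : ℝ) (x : E3) : ℝ :=
  ε ^ 2 * exp (-k * sE ε x) * (k^2 * sE ε x ^ 2 + 3 * k * sE ε x + 3) / sE ε x ^ 5

lemma norm_line (x : E3) (i : Fin 3) (t : ℝ) :
    ‖x + t • ei i‖ ^ 2 = ‖x‖ ^ 2 + 2 * t * x i + t ^ 2 := by
  rw [EuclideanSpace.real_norm_sq_eq, EuclideanSpace.real_norm_sq_eq]
  fin_cases i <;> simp [Fin.sum_univ_three, ei] <;> ring

lemma sE_line {ε : ℝ} (hε : 0 < ε) (x : E3) (i : Fin 3) :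
    HasLineDerivAt ℝ (sE ε) (x i / sE ε x) x (ei i) := by
  unfold HasLineDerivAt
  have h1 : (fun t : ℝ => sE ε (x + t • ei i)) =
      fun t => √(‖x‖ ^ 2 + 2 * t * x i + t ^ 2 + ε ^ 2) := by
    ext t; rw [sE, norm_line]
  rw [h1]
  have h2 : HasDerivAt (fun t : ℝ => ‖x‖ ^ 2 + 2 * t * x i + t ^ 2 + ε ^ 2) (2 * x i) 0 := by
    have := ((((hasDerivAt_id (0:ℝ)).const_mul 2).mul_const (x i)).const_add (‖x‖^2)).add
      ((hasDerivAt_id (0:ℝ)).pow 2) |>.add_const (ε ^ 2)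
    refine this.congr_deriv ?_
    simp
  have h3 := h2.sqrt (by have := sq_nonneg ‖x‖; have := pow_pos hε 2; simp; positivity)
  refine h3.congr_deriv ?_
  have := (sE_pos hε x).ne'
  unfold sE at *
  simp
  field_simp

lemma g0_line {k ε : ℝ} (hε : 0 < ε) (x : E3) (i : Fin 3) :
    HasLineDerivAt ℝ (g0 k ε) (g1 k ε i x) x (ei i) := by
  have hs := sE_line hε x i
  have hp := (sE_pos hε x).ne'
  unfold HasLineDerivAt at *
  have h := ((hs.const_mul (-k)).exp).div hs (by simpa using hp)
  refine h.congr_deriv ?_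
  simp [g1]
  field_simp
  ring

lemma coord_line (x : E3) (i : Fin 3) : HasLineDerivAt ℝ (fun y : E3 => y i) 1 x (ei i) := by
  unfold HasLineDerivAt
  have := ((hasDerivAt_id (0:ℝ)).const_add (x i))
  convert this using 1
  ext t; simp [ei]

lemma g1_line {k ε : ℝ} (hε : 0 < ε) (x : E3) (i : Fin 3) :
    HasLineDerivAt ℝ (g1 k ε i) (g2 k ε i x) x (ei i) := by
  have hs := sE_line hε x i
  have hc := coord_line x i
  have hp := (sE_pos hε x).ne'
  unfold HasLineDerivAt at *
  have h := hc.neg.mul ((((hs.const_mul (-k)).exp).mul ((hs.const_mul k).add_const 1)).div (hs.pow 3)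
    (by simpa using hp))
  refine h.congr_deriv ?_
  simp [g2]
  field_simp
  ring

lemma g_sum {k ε : ℝ} (hε : 0 < ε) (x : E3) :
    ∑ i, g2 k ε i x = k ^ 2 * g0 k ε x - rho k ε x := by
  have hp := (sE_pos hε x).ne'
  have h : ε ^ 2 = sE ε x ^ 2 - (x 0 ^ 2 + x 1 ^ 2 + x 2 ^ 2) := by
    rw [sE_sq, EuclideanSpace.real_norm_sq_eq, Fin.sum_univ_three]; ring
  simp only [g2, g0, rho, Fin.sum_univ_three, h]
  field_simp
  ring

lemma coord_le (ε : ℝ) (x : E3) (i : Fin 3) : |x i| ≤ sE ε x :=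
  (PiLp.norm_apply_le x i).trans (sE_norm ε x)

lemma exp1 {z : ℝ} : exp (-z) * (z + 1) ≤ 1 := by
  rw [Real.exp_neg, inv_mul_le_iff₀ (exp_pos z)]; linarith [Real.add_one_le_exp z]
lemma exp2 {z : ℝ} (hz : 0 ≤ z) : exp (-z) * (z ^ 2 + 3 * z + 3) ≤ 3 := by
  rw [Real.exp_neg, inv_mul_le_iff₀ (exp_pos z)]; nlinarith [Real.quadratic_le_exp_of_nonneg hz]

lemma g0_pos {k ε : ℝ} (hε : 0 < ε) (x : E3) : 0 < g0 k ε x :=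
  div_pos (exp_pos _) (sE_pos hε x)
lemma rho_nonneg {k ε : ℝ} (hk : 0 < k) (hε : 0 < ε) (x : E3) : 0 ≤ rho k ε x := by
  have := sE_pos hε x
  unfold rho; positivity

lemma g0_bd {k ε : ℝ} (hk : 0 < k) (hε : 0 < ε) (x : E3) : |g0 k ε x| ≤ 1 / ε := by
  rw [abs_of_pos (g0_pos hε x), g0]
  have := sE_pos hε x
  gcongr
  · exact Real.exp_le_one_iff.2 (by nlinarith)
  · exact sE_ge x

lemma aux1 {k ε : ℝ} (hk : 0 < k) (hε : 0 < ε) (x : E3) (n : ℕ) :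
    exp (-k * sE ε x) * (k * sE ε x + 1) / sE ε x ^ n ≤ 1 / ε ^ n := by
  have := sE_pos hε x
  gcongr
  · have := exp1 (z := k * sE ε x)
    simpa using this
  · exact sE_ge x
lemma aux2 {k ε : ℝ} (hk : 0 < k) (hε : 0 < ε) (x : E3) (n : ℕ) :
    exp (-k * sE ε x) * (k^2 * sE ε x ^ 2 + 3 * k * sE ε x + 3) / sE ε x ^ n ≤ 3 / ε ^ n := by
  have := sE_pos hε x
  gcongr
  · have := exp2 (z := k * sE ε x) (by positivity)
    refine le_trans (le_of_eq ?_) this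
    ring_nf
  · exact sE_ge x

lemma g1_bd {k ε : ℝ} (hk : 0 < k) (hε : 0 < ε) (i : Fin 3) (x : E3) : |g1 k ε i x| ≤ 1 / ε ^ 2 := by
  have hp := sE_pos hε x
  rw [g1, abs_mul, abs_neg, abs_of_nonneg (a := _ / _) (by positivity)]
  calc _ ≤ sE ε x * (exp (-k * sE ε x) * (k * sE ε x + 1) / sE ε x ^ 3) := by
        gcongr; exact coord_le ε x i
    _ = exp (-k * sE ε x) * (k * sE ε x + 1) / sE ε x ^ 2 := by field_simp
    _ ≤ _ := aux1 hk hε x 2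

lemma g2_bd {k ε : ℝ} (hk : 0 < k) (hε : 0 < ε) (i : Fin 3) (x : E3) :
    |g2 k ε i x| ≤ 1 / ε ^ 3 + 3 / ε ^ 3 := by
  have hp := sE_pos hε x
  rw [g2]
  refine (abs_add_le _ _).trans (add_le_add ?_ ?_)
  · rw [abs_neg, abs_of_nonneg (by positivity)]; exact aux1 hk hε x 3
  · rw [abs_of_nonneg (by positivity), ← sq_abs]
    calc _ ≤ sE ε x ^ 2 * (exp (-k * sE ε x) * (k^2 * sE ε x ^ 2 + 3 * k * sE ε x + 3) / sE ε x ^ 5) := by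
          gcongr; exact coord_le ε x i
      _ = exp (-k * sE ε x) * (k^2 * sE ε x ^ 2 + 3 * k * sE ε x + 3) / sE ε x ^ 3 := by field_simp
      _ ≤ _ := aux2 hk hε x 3

lemma rho_bd {k ε : ℝ} (hk : 0 < k) (hε : 0 < ε) (x : E3) : |rho k ε x| ≤ ε ^ 2 * (3 / ε ^ 5) := by
  rw [abs_of_nonneg (rho_nonneg hk hε x), rho, mul_assoc, mul_div_assoc]
  exact mul_le_mul_of_nonneg_left (aux2 hk hε x 5) (by positivity)

lemma g0_cont {k ε : ℝ} (hε : 0 < ε) : Continuous (g0 k ε) := by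
  have := sE_cont ε
  unfold g0
  exact Continuous.div (by fun_prop) this fun x => (sE_pos hε x).ne'
lemma g1_cont {k ε : ℝ} (hε : 0 < ε) (i : Fin 3) : Continuous (g1 k ε i) := by
  have := sE_cont ε
  unfold g1
  exact Continuous.mul (by fun_prop) (Continuous.div (by fun_prop) (by fun_prop)
    fun x => (pow_pos (sE_pos hε x) _).ne')
lemma g2_cont {k ε : ℝ} (hε : 0 < ε) (i : Fin 3) : Continuous (g2 k ε i) := by
  have := sE_cont ε
  unfold g2
  exact Continuous.add (Continuous.neg (Continuous.div (by fun_prop) (by fun_prop)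
    fun x => (pow_pos (sE_pos hε x) _).ne')) (Continuous.mul (by fun_prop) (Continuous.div (by fun_prop) (by fun_prop)
    fun x => (pow_pos (sE_pos hε x) _).ne'))
lemma rho_cont {k ε : ℝ} (hε : 0 < ε) : Continuous (rho k ε) := by
  have := sE_cont ε
  unfold rho
  exact Continuous.div (by fun_prop) (by fun_prop) fun x => (pow_pos (sE_pos hε x) _).ne'


lemma conv_int {H : E3 → ℝ} {C : ℝ} (hH : Continuous H) (hC : ∀ x, |H x| ≤ C)
    {μ : E3 → ℝ} (hμ : Integrable μ) (x : E3) : Integrable (fun y => H (x - y) * μ y) :=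
  hμ.bdd_mul (c := C) (by fun_prop) (ae_of_all _ fun y => hC _)

lemma conv_cont {H : E3 → ℝ} {C : ℝ} (hH : Continuous H) (hC : ∀ x, |H x| ≤ C)
    {μ : E3 → ℝ} (hμ : Integrable μ) : Continuous (fun x => ∫ y, H (x - y) * μ y) := by
  refine continuous_of_dominated (bound := fun y => C * |μ y|)
    (fun x => (conv_int hH hC hμ x).aestronglyMeasurable) ?_ (hμ.abs.const_mul C) ?_
  · intro x; refine ae_of_all _ fun y => ?_
    rw [norm_mul]; exact mul_le_mul_of_nonneg_right (hC _) (abs_nonneg _)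
  · refine ae_of_all _ fun y => by fun_prop

lemma conv_line {H H' : E3 → ℝ} {C C' : ℝ} (hH : Continuous H) (hC : ∀ x, |H x| ≤ C)
    (hH' : Continuous H') (hC' : ∀ x, |H' x| ≤ C') {v : E3}
    (hd : ∀ x, HasLineDerivAt ℝ H (H' x) x v)
    {μ : E3 → ℝ} (hμ : Integrable μ) (x : E3) :
    HasLineDerivAt ℝ (fun x => ∫ y, H (x - y) * μ y) (∫ y, H' (x - y) * μ y) x v := by
  unfold HasLineDerivAt
  have h := (hasDerivAt_integral_of_dominated_loc_of_deriv_le (𝕜 := ℝ) (μ := (volume : Measure E3))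
    (F := fun t y => H (x + t • v - y) * μ y) (F' := fun t y => H' (x + t • v - y) * μ y)
    (x₀ := 0) (s := Set.univ) (bound := fun y => C' * |μ y|) univ_mem
    (Eventually.of_forall fun t => (conv_int hH hC hμ _).aestronglyMeasurable)
    (conv_int hH hC hμ _) (conv_int hH' hC' hμ _).aestronglyMeasurable
    (ae_of_all _ fun y t _ => by
      rw [norm_mul]; exact mul_le_mul_of_nonneg_right (hC' _) (abs_nonneg _))
    (hμ.abs.const_mul C')
    (ae_of_all _ fun y t _ => by
      refine HasDerivAt.mul_const ?_ _
      have := hd (x + t • v - y)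
      unfold HasLineDerivAt at this
      have h2 : HasDerivAt (fun r : ℝ => r - t) 1 t := (hasDerivAt_id t).sub_const t
      have h3 := HasDerivAt.comp_of_eq (h₂ := fun s : ℝ => H (x + t • v - y + s • v)) t this h2 (by simp)
      simp only [mul_one] at h3
      refine h3.congr_of_eventuallyEq (Eventually.of_forall fun r => ?_)
      simp only [Function.comp]
      congr 1
      module)).2
  simpa using h

lemma sum_ei (a : Fin 3 → ℝ) : ‖∑ i, a i • ei i‖ ^ 2 = ∑ i, a i ^ 2 := by
  rw [EuclideanSpace.real_norm_sq_eq]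
  simp [Fin.sum_univ_three, ei]

lemma ground (φ : E3 → ℂ) (hφ : ContDiff ℝ (⊤ : ℕ∞) φ) (hc : HasCompactSupport φ)
    (U : E3 → ℝ) (U1 U2 : Fin 3 → E3 → ℝ) (hU : Continuous U) (hU1 : ∀ i, Continuous (U1 i))
    (hU2 : ∀ i, Continuous (U2 i)) (hpos : ∀ x, 0 < U x)
    (h1 : ∀ i x, HasLineDerivAt ℝ U (U1 i x) x (ei i))
    (h2 : ∀ i x, HasLineDerivAt ℝ (U1 i) (U2 i x) x (ei i)) :
    ∫ x, ‖φ x‖ ^ 2 / U x * (- ∑ i, U2 i x) ≤ ∫ x, ‖fderiv ℝ φ x‖ ^ 2 := by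
  have hφc := hφ.continuous
  have hdφ : Continuous (fderiv ℝ φ) := hφ.continuous_fderiv (by simp)
  have hcd : HasCompactSupport (fderiv ℝ φ) := hc.fderiv ℝ
  have hUne : ∀ x, U x ≠ 0 := fun x => (hpos x).ne'
  set N1 : Fin 3 → E3 → ℝ := fun i x => 2 * inner ℝ (φ x) (fderiv ℝ φ x (ei i)) with hN1
  have hN1c : ∀ i, Continuous (N1 i) := fun i => by
    have : Continuous fun x => fderiv ℝ φ x (ei i) := by fun_prop
    simp only [hN1]; fun_prop
  set ψ : E3 → ℝ := fun x => ‖φ x‖ ^ 2 / U x with hψ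
  set ψ1 : Fin 3 → E3 → ℝ := fun i x => (N1 i x * U x - ‖φ x‖ ^ 2 * U1 i x) / U x ^ 2 with hψ1
  have hψc : Continuous ψ := Continuous.div (by fun_prop) hU hUne
  have hψ1c : ∀ i, Continuous (ψ1 i) := fun i => by
    have := hN1c i
    have := hU1 i
    exact Continuous.div (by fun_prop) (by fun_prop) fun x => pow_ne_zero 2 (hUne x)
  have zero : ∀ x, φ x = 0 → ψ x = 0 ∧ ∀ i, ψ1 i x = 0 := fun x hx => by
    simp [hψ, hψ1, hN1, hx]
  have hψs : HasCompactSupport ψ := hc.mono fun x hx h => hx (zero x h).1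
  have hψ1s : ∀ i, HasCompactSupport (ψ1 i) := fun i => hc.mono fun x hx h => hx ((zero x h).2 i)
  have hline : ∀ i x, HasLineDerivAt ℝ ψ (ψ1 i x) x (ei i) := fun i x => by
    have hf : HasLineDerivAt ℝ φ (fderiv ℝ φ x (ei i)) x (ei i) :=
      ((hφ.differentiable (by simp) x).hasFDerivAt).hasLineDerivAt _
    have hu := h1 i x
    unfold HasLineDerivAt at *
    have h := (hf.norm_sq).div hu (by simpa using hUne x)
    refine h.congr_deriv ?_
    simp [hψ1, hN1]
  have ibp : ∀ i, ∫ x, ψ x * U2 i x = - ∫ x, ψ1 i x * U1 i x := fun i => by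
    refine integral_bilinear_hasLineDerivAt_right_eq_neg_left_of_integrable
      (B := ContinuousLinearMap.mul ℝ ℝ) (f := ψ) (f' := ψ1 i) (g := U1 i) (g' := U2 i) (v := ei i)
      ?_ ?_ ?_ (fun x _ => hline i x) (fun x _ => h2 i x)
    · exact ((hψ1c i).mul (hU1 i)).integrable_of_hasCompactSupport (hψ1s i).mul_right
    · exact (hψc.mul (hU2 i)).integrable_of_hasCompactSupport hψs.mul_right
    · exact (hψc.mul (hU1 i)).integrable_of_hasCompactSupport hψs.mul_right
  have e1 : ∫ x, ψ x * (- ∑ i, U2 i x) = ∫ x, ∑ i, ψ1 i x * U1 i x := by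
    rw [integral_finsetSum]
    · have : ∀ x, ψ x * (- ∑ i, U2 i x) = - ∑ i, ψ x * U2 i x := fun x => by
        rw [mul_neg, Finset.mul_sum]
      simp_rw [this]
      rw [integral_neg, integral_finsetSum]
      · simp [ibp]
      · intro i _
        exact (hψc.mul (hU2 i)).integrable_of_hasCompactSupport hψs.mul_right
    · intro i _
      exact ((hψ1c i).mul (hU1 i)).integrable_of_hasCompactSupport (hψ1s i).mul_right
  rw [e1]
  refine integral_mono ?_ ?_ ?_
  · refine integrable_finsetSum _ fun i _ => ?_
    exact ((hψ1c i).mul (hU1 i)).integrable_of_hasCompactSupport (hψ1s i).mul_right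
  · refine Continuous.integrable_of_hasCompactSupport (by fun_prop) ?_
    exact hcd.norm.comp_left (g := fun t : ℝ => t ^ 2) (by simp)
  · intro x
    simp only
    set v : E3 := ∑ i, (U1 i x / U x) • ei i with hv
    have hvn : ‖v‖ ^ 2 = ∑ i, (U1 i x / U x) ^ 2 := sum_ei _
    have hin : inner ℝ (φ x) (fderiv ℝ φ x v) = ∑ i, (U1 i x / U x) * inner ℝ (φ x) (fderiv ℝ φ x (ei i)) := by
      rw [hv, map_sum, inner_sum]; simp_rw [map_smul, inner_smul_right]
    have e : ∑ i, ψ1 i x * U1 i x = 2 * inner ℝ (φ x) (fderiv ℝ φ x v) - ‖φ x‖ ^ 2 * ‖v‖ ^ 2 := by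
      rw [hvn, hin, Finset.mul_sum, Finset.mul_sum, ← Finset.sum_sub_distrib]
      refine Finset.sum_congr rfl fun i _ => ?_
      have := hUne x
      simp only [hψ1, hN1]
      field_simp
    rw [e]
    have c1 := real_inner_le_norm (φ x) (fderiv ℝ φ x v)
    have c2 := mul_le_mul_of_nonneg_left ((fderiv ℝ φ x).le_opNorm v) (norm_nonneg (φ x))
    nlinarith [sq_nonneg (‖fderiv ℝ φ x‖ - ‖φ x‖ * ‖v‖)]

lemma lem4 (φ : E3 → ℂ) (hφ : ContDiff ℝ (⊤ : ℕ∞) φ) (hc : HasCompactSupport φ)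
    {k ε η : ℝ} (hk : 0 < k) (hε : 0 < ε) (hη : 0 < η) {μ : E3 → ℝ} (hμ : Integrable μ)
    (hμ0 : ∀ x, 0 ≤ μ x) :
    ∫ x, ‖φ x‖ ^ 2 / ((∫ y, g0 k ε (x - y) * μ y) + η) * (∫ y, rho k ε (x - y) * μ y) ≤
      (∫ x, ‖fderiv ℝ φ x‖ ^ 2) + k ^ 2 * ∫ x, ‖φ x‖ ^ 2 := by
  set u : E3 → ℝ := fun x => ∫ y, g0 k ε (x - y) * μ y with hu
  set r : E3 → ℝ := fun x => ∫ y, rho k ε (x - y) * μ y with hr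
  have huc : Continuous u := conv_cont (g0_cont hε) (g0_bd hk hε) hμ
  have hrc : Continuous r := conv_cont (rho_cont hε) (rho_bd hk hε) hμ
  have hu0 : ∀ x, 0 ≤ u x := fun x => integral_nonneg fun y =>
    mul_nonneg (g0_pos hε _).le (hμ0 y)
  have G := ground φ hφ hc (fun x => u x + η) (fun i x => ∫ y, g1 k ε i (x - y) * μ y)
    (fun i x => ∫ y, g2 k ε i (x - y) * μ y) (by fun_prop)
    (fun i => conv_cont (g1_cont hε i) (g1_bd hk hε i) hμ)
    (fun i => conv_cont (g2_cont hε i) (g2_bd hk hε i) hμ)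
    (fun x => by have := hu0 x; positivity)
    (fun i x => by
      have := conv_line (g0_cont hε) (g0_bd hk hε) (g1_cont hε i) (g1_bd hk hε i)
        (fun x => g0_line hε x i) hμ x
      unfold HasLineDerivAt at *
      exact this.add_const η)
    (fun i x => conv_line (g1_cont hε i) (g1_bd hk hε i) (g2_cont hε i) (g2_bd hk hε i)
        (fun x => g1_line hε x i) hμ x)
  have hsum : ∀ x, ∑ i, ∫ y, g2 k ε i (x - y) * μ y = k ^ 2 * u x - r x := fun x => by
    rw [← integral_finsetSum _ fun i _ => conv_int (g2_cont hε i) (g2_bd hk hε i) hμ x]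
    simp only [hu, hr]
    rw [← integral_const_mul, ← integral_sub ((conv_int (g0_cont hε) (g0_bd hk hε) hμ x).const_mul _)
      (conv_int (rho_cont hε) (rho_bd hk hε) hμ x)]
    congr 1; ext y
    rw [← Finset.sum_mul, g_sum hε]; ring
  simp_rw [hsum] at G
  have hφc := hφ.continuous
  have hne : ∀ x, u x + η ≠ 0 := fun x => by have := hu0 x; positivity
  have hψc : Continuous fun x => ‖φ x‖ ^ 2 / (u x + η) := Continuous.div (by fun_prop) (by fun_prop) hne
  have hψs : HasCompactSupport fun x => ‖φ x‖ ^ 2 / (u x + η) :=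
    hc.mono fun x hx h => hx (by simp [h])
  have i1 : Integrable fun x => ‖φ x‖ ^ 2 / (u x + η) * (-(k ^ 2 * u x - r x)) :=
    Continuous.integrable_of_hasCompactSupport (hψc.mul (by fun_prop)) hψs.mul_right
  have i2 : Integrable fun x => ‖φ x‖ ^ 2 := Continuous.integrable_of_hasCompactSupport (by fun_prop)
     (hc.norm.comp_left (g := fun t : ℝ => t ^ 2) (by simp))
  have i3 : Integrable fun x => ‖φ x‖ ^ 2 / (u x + η) * r x :=
    Continuous.integrable_of_hasCompactSupport (hψc.mul (by fun_prop)) hψs.mul_right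
  calc _ ≤ ∫ x, (‖φ x‖ ^ 2 / (u x + η) * (-(k ^ 2 * u x - r x)) + k ^ 2 * ‖φ x‖ ^ 2) := by
        refine integral_mono i3 (i1.add (i2.const_mul _)) fun x => ?_
        simp only
        have h1 : ‖φ x‖ ^ 2 / (u x + η) * u x ≤ ‖φ x‖ ^ 2 := by
          rw [div_mul_eq_mul_div, div_le_iff₀ (by have := hu0 x; positivity)]
          nlinarith [sq_nonneg ‖φ x‖]
        nlinarith [sq_nonneg k]
    _ = _ := by rw [integral_add i1 (i2.const_mul _), integral_const_mul]
    _ ≤ _ := by gcongr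


def GG (k : ℝ) (x : E3) : ℝ := exp (-k * ‖x‖) / ‖x‖

lemma GG_nonneg (k : ℝ) (x : E3) : 0 ≤ GG k x := by unfold GG; positivity

lemma GG_meas (k : ℝ) : Measurable (GG k) := by unfold GG; fun_prop

lemma GG_int {k : ℝ} (hk : 0 < k) : Integrable (GG k) := by
  unfold GG
  rw [integrable_fun_norm_addHaar (volume : Measure E3) (f := fun r : ℝ => exp (-k * r) / r)]
  have := integrableOn_rpow_mul_exp_neg_mul_rpow (p := 1) (s := 1) (b := k) (by norm_num) (by norm_num) hk
  refine this.congr_fun (fun y hy => ?_) measurableSet_Ioi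
  have : y ≠ 0 := (Set.mem_Ioi.1 hy).ne'
  simp
  field_simp

lemma g0_le {k ε : ℝ} (hk : 0 < k) {x : E3} (hx : x ≠ 0) : g0 k ε x ≤ GG k x := by
  unfold g0 GG
  have := norm_pos_iff.2 hx
  have h := sE_norm ε x
  exact div_le_div₀ (exp_pos _).le (Real.exp_le_exp.2 (by nlinarith)) this h

lemma ae_ne : ∀ᵐ x : E3, x ≠ 0 := by
  simp [ae_iff]

lemma g0_tendsto (k : ℝ) {x : E3} (hx : x ≠ 0) :
    Tendsto (fun ε => g0 k ε x) (𝓝[>] 0) (𝓝 (GG k x)) := by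
  have hp := norm_pos_iff.2 hx
  have hs : Tendsto (fun ε => sE ε x) (𝓝[>] 0) (𝓝 ‖x‖) := by
    have : Continuous fun ε => sE ε x := by unfold sE; fun_prop
    have h := this.tendsto 0
    simp only [sE] at h
    rw [show (√(‖x‖ ^ 2 + 0 ^ 2)) = ‖x‖ by simp] at h
    exact h.mono_left nhdsWithin_le_nhds
  unfold g0 GG
  exact Tendsto.div ((hs.const_mul (-k)).rexp) hs hp.ne'

lemma L1_tendsto {k : ℝ} (hk : 0 < k) :
    Tendsto (fun ε => ∫ x, |GG k x - g0 k ε x|) (𝓝[>] 0) (𝓝 0) := by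
  have := tendsto_integral_filter_of_dominated_convergence (μ := (volume : Measure E3))
    (F := fun ε x => |GG k x - g0 k ε x|) (f := fun _ => (0:ℝ)) (l := 𝓝[>] 0) (GG k) ?_ ?_ (GG_int hk) ?_
  · simpa using this
  · filter_upwards [self_mem_nhdsWithin] with ε hε
    have := (g0_cont (k := k) (Set.mem_Ioi.1 hε)).measurable
    have := GG_meas k
    exact Measurable.aestronglyMeasurable (by fun_prop)
  · filter_upwards [self_mem_nhdsWithin] with ε hε
    filter_upwards [ae_ne] with x hx
    have := g0_le (ε := ε) hk hx
    have := g0_pos (k := k) (Set.mem_Ioi.1 hε) x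
    rw [norm_eq_abs, abs_abs, abs_of_nonneg (by linarith)]; linarith
  · filter_upwards [ae_ne] with x hx
    have := ((g0_tendsto k hx).const_sub (GG k x)).abs
    simpa using this

lemma GGconv_int {k : ℝ} (hk : 0 < k) {μ : E3 → ℝ} (hμ : Measurable μ) {C : ℝ} (hC : ∀ x, |μ x| ≤ C) (x : E3) :
    Integrable (fun y => GG k (x - y) * μ y) :=
  ((GG_int hk).comp_sub_left x).mul_bdd (c := C) hμ.aestronglyMeasurable (ae_of_all _ hC)

lemma u0_cont {k : ℝ} (hk : 0 < k) {μ : E3 → ℝ} (hμ : Measurable μ) (hμi : Integrable μ)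
    {C : ℝ} (hC : ∀ x, |μ x| ≤ C) : Continuous (fun x => ∫ y, GG k (x - y) * μ y) := by
  have hC0 : 0 ≤ C := (abs_nonneg _).trans (hC 0)
  have key : TendstoUniformly (fun ε x => ∫ y, g0 k ε (x - y) * μ y)
      (fun x => ∫ y, GG k (x - y) * μ y) (𝓝[>] 0) := by
    rw [Metric.tendstoUniformly_iff]
    intro r hr
    have h1 := (L1_tendsto hk).const_mul C
    rw [mul_zero] at h1
    filter_upwards [self_mem_nhdsWithin, h1.eventually (gt_mem_nhds hr)] with ε hε hlt x
    have hε' := Set.mem_Ioi.1 hε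
    refine lt_of_le_of_lt ?_ hlt
    have hi : Integrable fun y => |GG k y - g0 k ε y| := by
      refine (GG_int hk).mono' ?_ ?_
      · have := (g0_cont (k := k) hε').measurable
        have := GG_meas k
        exact Measurable.aestronglyMeasurable (by fun_prop)
      · filter_upwards [ae_ne] with x hx
        have := g0_le (ε := ε) hk hx
        have := g0_pos (k := k) hε' x
        rw [norm_eq_abs, abs_abs, abs_of_nonneg (by linarith)]; linarith
    rw [Real.dist_eq, ← integral_sub (GGconv_int hk hμ hC x) (conv_int (g0_cont hε') (g0_bd hk hε') hμi x)]
    refine (abs_integral_le_integral_abs).trans ?_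
    rw [← integral_const_mul, ← integral_sub_left_eq_self (fun y => C * |GG k y - g0 k ε y|) volume x]
    refine integral_mono ((GGconv_int hk hμ hC x).sub (conv_int (g0_cont hε') (g0_bd hk hε') hμi x)).abs
      ((hi.const_mul C).comp_sub_left x) fun y => ?_
    simp only [← sub_mul, abs_mul]
    rw [mul_comm]
    exact mul_le_mul_of_nonneg_right (hC y) (abs_nonneg _)
  refine key.continuous (Eventually.frequently ?_)
  filter_upwards [self_mem_nhdsWithin] with ε hε
  exact conv_cont (g0_cont hε) (g0_bd hk hε) hμi

lemma P_int : Integrable (fun x : E3 => 3 / sE 1 x ^ 5) := by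
  have := (integrable_rpow_neg_one_add_norm_sq (E := E3) (μ := volume) (r := 5) (by simp; norm_num)).const_mul 3
  refine this.congr (ae_of_all _ fun x => ?_)
  simp only [sE]
  rw [Real.sqrt_eq_rpow, ← Real.rpow_natCast (_ ^ (1 / 2 : ℝ)) 5, ← Real.rpow_mul (by positivity),
    div_eq_mul_inv (3:ℝ), ← Real.rpow_neg (by positivity)]
  norm_num [add_comm]

lemma P_integral : ∫ x : E3, 3 / sE 1 x ^ 5 = 4 * π := by
  have := integral_fun_norm_addHaar (volume : Measure E3) (fun r : ℝ => 3 / √(r ^ 2 + 1 ^ 2) ^ 5)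
  simp only [sE]
  rw [this]
  have hb : (volume : Measure E3).real (Metric.ball 0 1) = π * 4 / 3 := by
    rw [Measure.real, EuclideanSpace.volume_ball_fin_three]
    simp; positivity
  have hI : ∫ y in Set.Ioi (0:ℝ), y ^ 2 * (3 / √(y ^ 2 + 1 ^ 2) ^ 5) = 1 - 0 ^ 3 / √((0:ℝ) ^ 2 + 1 ^ 2) ^ 3 := by
    refine integral_Ioi_of_hasDerivAt_of_nonneg (g := fun y => y ^ 3 / √(y ^ 2 + 1 ^ 2) ^ 3) ?_ ?_ ?_ ?_
    · refine Continuous.continuousWithinAt (Continuous.div (by fun_prop) (by fun_prop) fun x => ?_)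
      positivity
    · intro y hy
      have h0 : (0:ℝ) < y ^ 2 + 1 ^ 2 := by positivity
      have hs := (((hasDerivAt_id y).pow 2).add_const (1 ^ 2 : ℝ)).sqrt h0.ne'
      have h := ((hasDerivAt_id y).pow 3).div (hs.pow 3) (pow_pos (Real.sqrt_pos.2 h0) 3).ne'
      refine h.congr_deriv ?_
      have hq := Real.sq_sqrt h0.le
      have hsp := Real.sqrt_pos.2 h0
      simp at hq hsp ⊢
      set s := √(y ^ 2 + 1)
      field_simp
      rw [show s ^ 2 = y^2+1 from hq]
      ring
    · intro y hy; positivity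
    · have h1 : Tendsto (fun y : ℝ => (√(1 + (y⁻¹) ^ 2) ^ 3)⁻¹) atTop (𝓝 1) := by
        have hc : Continuous fun z : ℝ => (√(1 + z ^ 2) ^ 3)⁻¹ :=
          Continuous.inv₀ (by fun_prop) fun z => by positivity
        have := (hc.tendsto 0).comp tendsto_inv_atTop_zero
        simpa [Function.comp_def] using this
      refine h1.congr' ?_
      filter_upwards [eventually_gt_atTop 0] with y hy
      have : √(y ^ 2 + 1 ^ 2) = y * √(1 + (y⁻¹) ^ 2) := by
        rw [← Real.sqrt_sq hy.le, ← Real.sqrt_mul (by positivity), Real.sqrt_sq hy.le]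
        congr 1; field_simp
        try ring
      rw [this]
      have : √(1 + (y⁻¹) ^ 2) ≠ 0 := by positivity
      field_simp
  simp only [finrank_euclideanSpace, Fintype.card_fin, smul_eq_mul, nsmul_eq_mul, hb]
  norm_num at hI ⊢
  rw [hI]; ring

lemma sE_scale {ε : ℝ} (hε : 0 < ε) (z : E3) : sE ε (ε • z) = ε * sE 1 z := by
  unfold sE
  rw [norm_smul, norm_eq_abs, abs_of_pos hε]
  rw [show (ε * ‖z‖) ^ 2 + ε ^ 2 = ε ^ 2 * (‖z‖ ^ 2 + 1 ^ 2) by ring, Real.sqrt_mul (by positivity),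
    Real.sqrt_sq hε.le]

def Rk (k ε : ℝ) (z : E3) : ℝ :=
  exp (-k * (ε * sE 1 z)) * (k^2 * (ε * sE 1 z) ^ 2 + 3 * k * (ε * sE 1 z) + 3) / sE 1 z ^ 5

lemma Rk_bd {k ε : ℝ} (hk : 0 < k) (hε : 0 < ε) (z : E3) : |Rk k ε z| ≤ 3 / sE 1 z ^ 5 := by
  have hp := sE_pos one_pos z
  unfold Rk
  rw [abs_of_nonneg (by positivity)]
  gcongr
  have := exp2 (z := k * (ε * sE 1 z)) (by positivity)
  refine le_trans (le_of_eq ?_) this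
  ring_nf

lemma rho_scale (k : ℝ) {ε : ℝ} (hε : 0 < ε) (h : E3 → ℝ) (y : E3) :
    ∫ x, rho k ε (x - y) * h x = ∫ z, Rk k ε z * h (ε • z + y) := by
  rw [← integral_add_right_eq_self _ y]
  simp only [add_sub_cancel_right]
  have h1 := Measure.integral_comp_smul (volume : Measure E3) (fun x => rho k ε x * h (x + y)) ε
  simp only [finrank_euclideanSpace, Fintype.card_fin, smul_eq_mul] at h1
  rw [abs_of_pos (by positivity)] at h1
  have h2 : ∫ x, rho k ε x * h (x + y) = ε ^ 3 * ∫ z, rho k ε (ε • z) * h (ε • z + y) := by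
    rw [h1]; field_simp
  rw [h2, ← integral_const_mul]
  congr 1; ext z
  have hp := (sE_pos one_pos z).ne'
  simp only [rho, Rk, sE_scale hε]
  field_simp

lemma Rk_cont (k ε : ℝ) : Continuous (Rk k ε) := by
  have := sE_cont 1
  unfold Rk
  exact Continuous.div (by fun_prop) (by fun_prop) fun x => (pow_pos (sE_pos one_pos x) _).ne'

lemma rho_conv_bd {k ε : ℝ} (hk : 0 < k) (hε : 0 < ε) {h : E3 → ℝ} {B : ℝ}
    (hB : ∀ x, |h x| ≤ B) (y : E3) : |∫ x, rho k ε (x - y) * h x| ≤ 4 * π * B := by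
  have hB0 : 0 ≤ B := (abs_nonneg _).trans (hB 0)
  rw [rho_scale k hε, ← P_integral, ← integral_mul_const]
  rw [← norm_eq_abs]
  refine norm_integral_le_of_norm_le (P_int.mul_const B) (ae_of_all _ fun z => ?_)
  rw [norm_mul]
  exact mul_le_mul (Rk_bd hk hε z) (hB _) (abs_nonneg _) (by have := sE_pos one_pos z; positivity)

lemma rho_conv_tendsto {k : ℝ} (hk : 0 < k) {h : E3 → ℝ} (hh : Continuous h) {B : ℝ}
    (hB : ∀ x, |h x| ≤ B) (y : E3) :
    Tendsto (fun ε => ∫ x, rho k ε (x - y) * h x) (𝓝[>] 0) (𝓝 (4 * π * h y)) := by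
  have hB0 : 0 ≤ B := (abs_nonneg _).trans (hB 0)
  have T : Tendsto (fun ε => ∫ z, Rk k ε z * h (ε • z + y)) (𝓝[>] 0)
      (𝓝 (∫ z, 3 / sE 1 z ^ 5 * h y)) := by
    refine tendsto_integral_filter_of_dominated_convergence (fun z => 3 / sE 1 z ^ 5 * B) ?_ ?_
      (P_int.mul_const B) ?_
    · refine Eventually.of_forall fun ε => ?_
      have := Rk_cont k ε
      exact Continuous.aestronglyMeasurable (by fun_prop)
    · filter_upwards [self_mem_nhdsWithin] with ε hε
      refine ae_of_all _ fun z => ?_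
      rw [norm_mul]
      exact mul_le_mul (Rk_bd hk hε z) (hB _) (abs_nonneg _) (by have := sE_pos one_pos z; positivity)
    · refine ae_of_all _ fun z => ?_
      have hc : Continuous fun ε : ℝ => Rk k ε z * h (ε • z + y) := by
        unfold Rk; fun_prop
      have := hc.tendsto 0
      have e : Rk k 0 z * h ((0 : ℝ) • z + y) = 3 / sE 1 z ^ 5 * h y := by simp [Rk]
      rw [e] at this
      exact this.mono_left nhdsWithin_le_nhds
  rw [integral_mul_const, P_integral] at T
  refine T.congr' ?_
  filter_upwards [self_mem_nhdsWithin] with ε hε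
  rw [rho_scale k hε]

lemma mollify {k : ℝ} (hk : 0 < k) {h μ : E3 → ℝ} (hh : Continuous h) (hhi : Integrable h) {B : ℝ}
    (hB : ∀ x, |h x| ≤ B) (hμ : Integrable μ) :
    Tendsto (fun ε => ∫ x, h x * ∫ y, rho k ε (x - y) * μ y) (𝓝[>] 0) (𝓝 (∫ y, 4 * π * h y * μ y)) := by
  have T : Tendsto (fun ε => ∫ y, (∫ x, rho k ε (x - y) * h x) * μ y) (𝓝[>] 0)
      (𝓝 (∫ y, 4 * π * h y * μ y)) := by
    refine tendsto_integral_filter_of_dominated_convergence (fun y => 4 * π * B * |μ y|) ?_ ?_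
      (hμ.abs.const_mul _) ?_
    · filter_upwards [self_mem_nhdsWithin] with ε hε
      have hε := Set.mem_Ioi.1 hε
      refine AEStronglyMeasurable.mul ?_ hμ.aestronglyMeasurable
      have hr := rho_cont (k := k) hε
      refine Continuous.aestronglyMeasurable (continuous_of_dominated (bound := fun x => ε ^ 2 * (3 / ε ^ 5) * |h x|)
        (fun y => Continuous.aestronglyMeasurable (by fun_prop)) ?_ (hhi.abs.const_mul _)
        (ae_of_all _ fun x => by fun_prop))
      intro y; refine ae_of_all _ fun x => ?_
      rw [norm_mul]; exact mul_le_mul_of_nonneg_right (rho_bd hk hε _) (abs_nonneg _)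
    · filter_upwards [self_mem_nhdsWithin] with ε hε
      refine ae_of_all _ fun y => ?_
      rw [norm_mul]
      exact mul_le_mul_of_nonneg_right (rho_conv_bd hk hε hB y) (abs_nonneg _)
    · exact ae_of_all _ fun y => (rho_conv_tendsto hk hh hB y).mul_const _
  refine T.congr' ?_
  filter_upwards [self_mem_nhdsWithin] with ε hε
  have hr := rho_cont (k := k) (Set.mem_Ioi.1 hε)
  simp_rw [← integral_mul_const, ← integral_const_mul]
  rw [integral_integral_swap]
  · congr 1; ext x; congr 1; ext y; ring
  · have : Integrable (fun p : E3 × E3 => μ p.1 * h p.2) (volume.prod volume) := hμ.mul_prod hhi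
    have := this.bdd_mul (f := fun p : E3 × E3 => rho k ε (p.2 - p.1)) (c := ε ^ 2 * (3 / ε ^ 5))
      (Continuous.aestronglyMeasurable (by fun_prop)) (ae_of_all _ fun p => rho_bd hk hε _)
    refine this.congr (ae_of_all _ fun p => ?_)
    simp [Function.uncurry]; ring

lemma lem5 (φ : E3 → ℂ) (hφ : ContDiff ℝ (⊤ : ℕ∞) φ) (hc : HasCompactSupport φ)
    {k η : ℝ} (hk : 0 < k) (hη : 0 < η) {μ : E3 → ℝ} (hμm : Measurable μ) (hμ : Integrable μ)
    (hμ0 : ∀ x, 0 ≤ μ x) {C : ℝ} (hC : ∀ x, |μ x| ≤ C) :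
    ∫ x, 4 * π * (‖φ x‖ ^ 2 / ((∫ y, GG k (x - y) * μ y) + η)) * μ x ≤
      (∫ x, ‖fderiv ℝ φ x‖ ^ 2) + k ^ 2 * ∫ x, ‖φ x‖ ^ 2 := by
  have huc := u0_cont hk hμm hμ hC
  set u : E3 → ℝ := fun x => ∫ y, GG k (x - y) * μ y with hu
  have hu0 : ∀ x, 0 ≤ u x := fun x => integral_nonneg fun y =>
    mul_nonneg (GG_nonneg _ _) (hμ0 y)
  have hφc := hφ.continuous
  have hψc : Continuous fun x => ‖φ x‖ ^ 2 / (u x + η) := Continuous.div (by fun_prop) (by fun_prop)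
    fun x => by have := hu0 x; positivity
  have hψs : HasCompactSupport fun x => ‖φ x‖ ^ 2 / (u x + η) :=
    hc.mono fun x hx h => hx (by simp [h])
  obtain ⟨B, hB⟩ := hψc.bounded_above_of_compact_support hψs
  refine le_of_tendsto (mollify hk hψc (hψc.integrable_of_hasCompactSupport hψs) hB hμ) ?_
  filter_upwards [self_mem_nhdsWithin] with ε hε
  have hε := Set.mem_Ioi.1 hε
  refine le_trans ?_ (lem4 φ hφ hc hk hε hη hμ hμ0)
  have hrc : Continuous fun x => ∫ y, rho k ε (x - y) * μ y := conv_cont (rho_cont hε) (rho_bd hk hε) hμ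
  have hgc : Continuous fun x => ∫ y, g0 k ε (x - y) * μ y := conv_cont (g0_cont hε) (g0_bd hk hε) hμ
  have hg0 : ∀ x, 0 ≤ ∫ y, g0 k ε (x - y) * μ y := fun x => integral_nonneg fun y =>
    mul_nonneg (g0_pos hε _).le (hμ0 y)
  refine integral_mono ((hψc.mul hrc).integrable_of_hasCompactSupport hψs.mul_right) ?_ fun x => ?_
  · refine Continuous.integrable_of_hasCompactSupport ((Continuous.div (by fun_prop) (by fun_prop)
      fun x => ?_).mul hrc) (hc.mono fun x hx h => hx (by simp [h]))
    have := hg0 x; positivity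
  · have h1 : 0 ≤ ∫ y, rho k ε (x - y) * μ y := integral_nonneg fun y =>
      mul_nonneg (rho_nonneg hk hε _) (hμ0 y)
    have h2 : ∫ y, g0 k ε (x - y) * μ y ≤ u x := by
      refine integral_mono_ae (conv_int (g0_cont hε) (g0_bd hk hε) hμ x) (GGconv_int hk hμm hC x) ?_
      have : ∀ᵐ y : E3, y ≠ x := by simp [ae_iff]
      filter_upwards [this] with y hy
      exact mul_le_mul_of_nonneg_right (g0_le hk (sub_ne_zero.2 hy.symm)) (hμ0 y)
    have := hg0 x
    simp only
    gcongr


lemma amgm {c f w : ℝ} (hc : 0 < c) (hw : 0 < w) : 2 * f ≤ c * (f ^ 2 / w) + w / c := by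
  have : c * (f ^ 2 / w) + w / c - 2 * f = (c * f - w) ^ 2 / (c * w) := by field_simp; ring
  have h : 0 ≤ (c * f - w) ^ 2 / (c * w) := by positivity
  linarith

lemma W_int {W h : E3 → ℝ} (hW : Measurable W) {M : ℝ} (hM : ∀ x, |W x| ≤ M) (hh : Continuous h)
    (hs : HasCompactSupport h) : Integrable fun x => W x * h x :=
  (hh.integrable_of_hasCompactSupport hs).bdd_mul hW.aestronglyMeasurable (ae_of_all _ hM)

lemma lem6 (φ : E3 → ℂ) (hφ : ContDiff ℝ (⊤ : ℕ∞) φ) (hc : HasCompactSupport φ)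
    {k δ : ℝ} (hk : 0 < k) (hδ : 0 < δ) {W : E3 → ℝ} (hW : Measurable W)
    (hW0 : ∀ x, 0 ≤ W x) {M : ℝ} (hM : ∀ x, |W x| ≤ M) :
    2 * ∫ x, W x * ‖φ x‖ ^ 2 ≤ δ * ((∫ x, ‖fderiv ℝ φ x‖ ^ 2) + k ^ 2 * ∫ x, ‖φ x‖ ^ 2)
      + (∫ x, (W x * ‖φ x‖) * ∫ y, GG k (x - y) * (W y * ‖φ y‖)) / (4 * π * δ) := by
  have hφc := hφ.continuous
  set μ : E3 → ℝ := fun x => W x * ‖φ x‖ with hμdef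
  have hμm : Measurable μ := by have := hφc.measurable; fun_prop
  have hμ : Integrable μ := W_int hW hM (by fun_prop) hc.norm
  have hμ0 : ∀ x, 0 ≤ μ x := fun x => mul_nonneg (hW0 x) (norm_nonneg _)
  obtain ⟨B, hB⟩ := hφc.bounded_above_of_compact_support hc
  have hM0 : 0 ≤ M := (abs_nonneg _).trans (hM 0)
  have hC : ∀ x, |μ x| ≤ M * B := fun x => by
    rw [hμdef, abs_mul, abs_norm]
    exact mul_le_mul (hM x) (hB x) (norm_nonneg _) hM0
  have huc := u0_cont hk hμm hμ hC
  set u : E3 → ℝ := fun x => ∫ y, GG k (x - y) * μ y with hu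
  have hu0 : ∀ x, 0 ≤ u x := fun x => integral_nonneg fun y =>
    mul_nonneg (GG_nonneg _ _) (hμ0 y)
  have hpi := Real.pi_pos
  have iu : Integrable fun x => μ x * u x := by
    have := W_int hW hM (h := fun x => ‖φ x‖ * u x) (by fun_prop) hc.norm.mul_right
    simpa [hμdef, mul_assoc] using this
  have step : ∀ η : ℝ, 0 < η → 2 * ∫ x, W x * ‖φ x‖ ^ 2 ≤
      δ * ((∫ x, ‖fderiv ℝ φ x‖ ^ 2) + k ^ 2 * ∫ x, ‖φ x‖ ^ 2)
      + ((∫ x, μ x * u x) + η * ∫ x, μ x) / (4 * π * δ) := by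
    intro η hη
    have L := lem5 φ hφ hc hk hη hμm hμ hμ0 hC
    change ∫ x, 4 * π * (‖φ x‖ ^ 2 / (u x + η)) * μ x ≤ _ at L
    have i1 : Integrable fun x => W x * ‖φ x‖ ^ 2 := W_int hW hM (by fun_prop)
      (hc.norm.comp_left (g := fun t : ℝ => t ^ 2) (by simp))
    have i2 : Integrable fun x => 4 * π * (‖φ x‖ ^ 2 / (u x + η)) * μ x := by
      have hd : Continuous fun x => ‖φ x‖ ^ 2 / (u x + η) := Continuous.div (by fun_prop) (by fun_prop)
        fun x => by have := hu0 x; positivity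
      have := W_int hW hM (h := fun x => 4 * π * (‖φ x‖ ^ 2 / (u x + η)) * ‖φ x‖)
        ((continuous_const.mul hd).mul hφc.norm) (hc.mono fun x hx h => hx (by simp [h]))
      refine this.congr (ae_of_all _ fun x => ?_)
      simp only [hμdef]; ring
    calc 2 * ∫ x, W x * ‖φ x‖ ^ 2 = ∫ x, 2 * (W x * ‖φ x‖ ^ 2) := by rw [integral_const_mul]
      _ ≤ ∫ x, (δ * (4 * π * (‖φ x‖ ^ 2 / (u x + η)) * μ x) + (μ x * u x + η * μ x) / (4 * π * δ)) := by
          refine integral_mono (i1.const_mul 2) ((i2.const_mul δ).add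
            ((iu.add (hμ.const_mul η)).div_const _)) fun x => ?_
          simp only
          have := mul_le_mul_of_nonneg_left (amgm (c := 4 * π * δ) (f := ‖φ x‖) (w := u x + η)
            (by positivity) (by have := hu0 x; positivity)) (hμ0 x)
          refine le_trans (le_of_eq ?_) (this.trans (le_of_eq ?_))
          · simp only [hμdef]; ring
          · ring
      _ = δ * (∫ x, 4 * π * (‖φ x‖ ^ 2 / (u x + η)) * μ x) + ((∫ x, μ x * u x) + η * ∫ x, μ x) / (4 * π * δ) := by
          have i3 : Integrable fun x => (μ x * u x + η * μ x) / (4 * π * δ) :=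
            (iu.add (hμ.const_mul η)).div_const _
          rw [integral_add (i2.const_mul δ) i3, integral_const_mul,
            integral_div, integral_add iu (hμ.const_mul η), integral_const_mul]
      _ ≤ _ := by gcongr
  have T : Tendsto (fun η : ℝ => δ * ((∫ x, ‖fderiv ℝ φ x‖ ^ 2) + k ^ 2 * ∫ x, ‖φ x‖ ^ 2)
      + ((∫ x, μ x * u x) + η * ∫ x, μ x) / (4 * π * δ)) (𝓝[>] 0) (𝓝 (δ * ((∫ x, ‖fderiv ℝ φ x‖ ^ 2) + k ^ 2 * ∫ x, ‖φ x‖ ^ 2)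
      + (∫ x, μ x * u x) / (4 * π * δ))) := by
    have hcont : Continuous (fun η : ℝ => δ * ((∫ x, ‖fderiv ℝ φ x‖ ^ 2) + k ^ 2 * ∫ x, ‖φ x‖ ^ 2)
      + ((∫ x, μ x * u x) + η * ∫ x, μ x) / (4 * π * δ)) := by fun_prop
    have := hcont.tendsto 0
    simp only [zero_mul, add_zero] at this
    exact this.mono_left nhdsWithin_le_nhds
  refine ge_of_tendsto T ?_
  filter_upwards [self_mem_nhdsWithin] with η hη
  exact step η hη

lemma lem7 {k D : ℝ} (hk : 0 < k) (hD : 0 < D) {V W f : E3 → ℝ} (hV : Measurable V) (hW : Measurable W)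
    (hW0 : ∀ x, 0 ≤ W x) (hWV : ∀ x, W x ≤ |V x|) {M : ℝ} (hM : ∀ x, |W x| ≤ M)
    (hf : Continuous f) (hf0 : ∀ x, 0 ≤ f x) (hfs : HasCompactSupport f)
    (hBS : (∫⁻ x, ∫⁻ y, ENNReal.ofReal (|V x| * |V y| * Real.exp (-2 * k * ‖x - y‖) / ‖x - y‖ ^ 2))
      ≤ ENNReal.ofReal (D ^ 2)) (hA : 0 < ∫ x, W x * f x ^ 2) :
    ∫ x, (W x * f x) * ∫ y, GG k (x - y) * (W y * f y) ≤ D * ∫ x, W x * f x ^ 2 := by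
  set A := ∫ x, W x * f x ^ 2 with hAdef
  have i1 : Integrable fun x => W x * f x ^ 2 := W_int hW hM (by fun_prop)
      (hfs.comp_left (g := fun t : ℝ => t ^ 2) (by simp))
  have hfm := hf.measurable
  have hμm : Measurable fun x => W x * f x := by fun_prop
  obtain ⟨B, hB⟩ := hf.bounded_above_of_compact_support hfs
  have hM0 : 0 ≤ M := (abs_nonneg _).trans (hM 0)
  have hC : ∀ x, |W x * f x| ≤ M * B := fun x => by
    rw [abs_mul]
    exact mul_le_mul (hM x) (hB x) (abs_nonneg _) hM0
  have hn : ∀ x, 0 ≤ W x * f x := fun x => mul_nonneg (hW0 x) (hf0 x)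
  have hn2 : ∀ x, 0 ≤ W x * f x ^ 2 := fun x => mul_nonneg (hW0 x) (sq_nonneg _)
  have hlA : ∫⁻ x, ENNReal.ofReal (W x * f x ^ 2) = ENNReal.ofReal A :=
    (ofReal_integral_eq_lintegral_ofReal i1 (ae_of_all _ hn2)).symm
  have hμ : Integrable fun x => W x * f x := W_int hW hM hf hfs
  have huc := u0_cont hk hμm hμ hC
  have hu0 : ∀ x, 0 ≤ ∫ y, GG k (x - y) * (W y * f y) := fun x => integral_nonneg fun y =>
    mul_nonneg (GG_nonneg _ _) (hn y)
  rw [integral_eq_lintegral_of_nonneg_ae (ae_of_all _ fun x => mul_nonneg (hn x) (hu0 x))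
    (hμ.aestronglyMeasurable.mul huc.aestronglyMeasurable)]
  refine ENNReal.toReal_le_of_le_ofReal (by positivity) ?_
  have e1 : ∀ x, ENNReal.ofReal ((W x * f x) * ∫ y, GG k (x - y) * (W y * f y)) =
      ∫⁻ y, ENNReal.ofReal ((W x * f x) * (GG k (x - y) * (W y * f y))) := fun x => by
    rw [← integral_const_mul, ofReal_integral_eq_lintegral_ofReal]
    · exact (GGconv_int hk hμm hC x).const_mul _
    · exact ae_of_all _ fun y => mul_nonneg (hn x) (mul_nonneg (GG_nonneg _ _) (hn y))
  simp_rw [e1]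
  have a1 : 0 ≤ A / (2 * D) := by positivity
  have a2 : 0 ≤ D / (2 * A) := by positivity
  have pt : ∀ x y, ENNReal.ofReal ((W x * f x) * (GG k (x - y) * (W y * f y))) ≤
      ENNReal.ofReal (A / (2 * D)) * ENNReal.ofReal (|V x| * |V y| * Real.exp (-2 * k * ‖x - y‖) / ‖x - y‖ ^ 2)
      + ENNReal.ofReal (D / (2 * A)) * (ENNReal.ofReal (W x * f x ^ 2) * ENNReal.ofReal (W y * f y ^ 2)) := by
    intro x y
    rw [← ENNReal.ofReal_mul (hn2 x), ← ENNReal.ofReal_mul a1, ← ENNReal.ofReal_mul a2,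
      ← ENNReal.ofReal_add (by positivity) (mul_nonneg a2 (mul_nonneg (hn2 x) (hn2 y)))]
    refine ENNReal.ofReal_le_ofReal ?_
    have hG : Real.exp (-2 * k * ‖x - y‖) / ‖x - y‖ ^ 2 = GG k (x - y) ^ 2 := by
      rw [GG, div_pow, ← Real.exp_nat_mul]; congr 2; push_cast; ring
    rw [mul_div_assoc, hG]
    set G := GG k (x - y)
    have hWW : W x * W y ≤ |V x| * |V y| := mul_le_mul (hWV x) (hWV y) (hW0 y) (abs_nonneg _)
    have hWW0 : 0 ≤ W x * W y := mul_nonneg (hW0 x) (hW0 y)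
    have h1 : f x * f y * G ≤ A / (2 * D) * G ^ 2 + D / (2 * A) * (f x ^ 2 * f y ^ 2) := by
      have : A / (2 * D) * G ^ 2 + D / (2 * A) * (f x ^ 2 * f y ^ 2) - f x * f y * G
        = (A * G - D * (f x * f y)) ^ 2 / (2 * A * D) := by field_simp; ring
      have h : 0 ≤ (A * G - D * (f x * f y)) ^ 2 / (2 * A * D) := by positivity
      linarith
    calc _ = (W x * W y) * (f x * f y * G) := by ring
      _ ≤ (W x * W y) * (A / (2 * D) * G ^ 2 + D / (2 * A) * (f x ^ 2 * f y ^ 2)) :=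
          mul_le_mul_of_nonneg_left h1 hWW0
      _ = (W x * W y) * (A / (2 * D) * G ^ 2) + D / (2 * A) * (W x * f x ^ 2 * (W y * f y ^ 2)) := by ring
      _ ≤ (|V x| * |V y|) * (A / (2 * D) * G ^ 2) + D / (2 * A) * (W x * f x ^ 2 * (W y * f y ^ 2)) := by
          gcongr
      _ = _ := by ring
  have m1 : Measurable fun y => ENNReal.ofReal (W y * f y ^ 2) := by fun_prop
  calc _ ≤ ∫⁻ x, ∫⁻ y, (ENNReal.ofReal (A / (2 * D)) * ENNReal.ofReal (|V x| * |V y| * Real.exp (-2 * k * ‖x - y‖) / ‖x - y‖ ^ 2)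
      + ENNReal.ofReal (D / (2 * A)) * (ENNReal.ofReal (W x * f x ^ 2) * ENNReal.ofReal (W y * f y ^ 2))) :=
        lintegral_mono fun x => lintegral_mono fun y => pt x y
    _ = ∫⁻ x, ((ENNReal.ofReal (A / (2 * D)) * ∫⁻ y, ENNReal.ofReal (|V x| * |V y| * Real.exp (-2 * k * ‖x - y‖) / ‖x - y‖ ^ 2))
      + ENNReal.ofReal (D / (2 * A)) * (ENNReal.ofReal (W x * f x ^ 2) * ENNReal.ofReal A)) := by
        refine lintegral_congr fun x => ?_
        rw [lintegral_add_right _ ((m1.const_mul _).const_mul _), lintegral_const_mul' _ _ ENNReal.ofReal_ne_top,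
          lintegral_const_mul' _ _ ENNReal.ofReal_ne_top, lintegral_const_mul' _ _ ENNReal.ofReal_ne_top, hlA]
    _ = ENNReal.ofReal (A / (2 * D)) * (∫⁻ x, ∫⁻ y, ENNReal.ofReal (|V x| * |V y| * Real.exp (-2 * k * ‖x - y‖) / ‖x - y‖ ^ 2))
      + ENNReal.ofReal (D / (2 * A)) * (ENNReal.ofReal A * ENNReal.ofReal A) := by
        rw [lintegral_add_right _ ((m1.mul_const _).const_mul _), lintegral_const_mul' _ _ ENNReal.ofReal_ne_top,
          lintegral_const_mul' _ _ ENNReal.ofReal_ne_top, lintegral_mul_const' _ _ ENNReal.ofReal_ne_top, hlA]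
    _ ≤ ENNReal.ofReal (A / (2 * D)) * ENNReal.ofReal (D ^ 2)
      + ENNReal.ofReal (D / (2 * A)) * (ENNReal.ofReal A * ENNReal.ofReal A) := by gcongr
    _ = ENNReal.ofReal (D * A) := by
        rw [← ENNReal.ofReal_mul hA.le, ← ENNReal.ofReal_mul a1, ← ENNReal.ofReal_mul a2,
          ← ENNReal.ofReal_add (by positivity) (by positivity)]
        congr 1; field_simp; ring

lemma lem8 (V : E3 → ℝ) (hV : Measurable V)
    (lam δ : ℝ) (hlam : 0 < lam) (hδ : 0 < δ)
    (hBS : (∫⁻ x : E3, ∫⁻ y, ENNReal.ofReal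
        (|V x| * |V y| * Real.exp (-2 * Real.sqrt lam * ‖x - y‖) / ‖x - y‖ ^ 2))
      ≤ ENNReal.ofReal ((4 * π) ^ 2 * δ ^ 2))
    (φ : E3 → ℂ) (hφ : ContDiff ℝ (⊤ : ℕ∞) φ) (hc : HasCompactSupport φ) (n : ℕ) :
    ∫ x, min |V x| n * ‖φ x‖ ^ 2 ≤ δ * ((∫ x, ‖fderiv ℝ φ x‖ ^ 2) + lam * ∫ x, ‖φ x‖ ^ 2) := by
  have hk := Real.sqrt_pos.2 hlam
  have hW : Measurable fun x => min |V x| (n : ℝ) := by fun_prop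
  have hW0 : ∀ x, 0 ≤ min |V x| (n : ℝ) := fun x => le_min (abs_nonneg _) (Nat.cast_nonneg n)
  have hM : ∀ x, |min |V x| (n : ℝ)| ≤ n := fun x => by
    rw [abs_of_nonneg (hW0 x)]; exact min_le_right _ _
  have hpi := Real.pi_pos
  have h6 := lem6 φ hφ hc hk hδ hW hW0 hM
  rw [Real.sq_sqrt hlam.le] at h6
  rw [← mul_pow] at hBS
  rcases (integral_nonneg (fun x => mul_nonneg (hW0 x) (sq_nonneg ‖φ x‖)) :
    0 ≤ ∫ x, min |V x| (n : ℝ) * ‖φ x‖ ^ 2).eq_or_lt with h0 | h0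
  · rw [← h0]
    have := integral_nonneg (μ := (volume : Measure E3)) (f := fun x => ‖fderiv ℝ φ x‖ ^ 2) fun x => sq_nonneg ‖fderiv ℝ φ x‖
    have := integral_nonneg (μ := (volume : Measure E3)) (f := fun x => ‖φ x‖ ^ 2) fun x => sq_nonneg ‖φ x‖
    positivity
  · have h7 := lem7 hk (D := 4 * π * δ) (by positivity) hV hW hW0 (fun x => min_le_left _ _) hM hφ.continuous.norm
      (fun x => norm_nonneg _) hc.norm hBS h0
    have h8 := div_le_div_of_nonneg_right h7 (show 0 ≤ 4 * π * δ by positivity)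
    rw [mul_div_cancel_left₀ _ (by positivity)] at h8
    linarith

/-- If the squared Hilbert–Schmidt norm of the Birman–Schwinger operator
`√|V|(-Δ+λ)⁻¹√|V|`, i.e. `(1/(4π)²)∬ |V(x)||V(y)|e^{-2√λ|x-y|}/|x-y|² dx dy`,
is at most `δ²`, then `|∫ V |φ|²| ≤ δ(∫ ‖∇φ‖² + λ ∫ |φ|²)` for all smooth compactly
supported `φ`: a Rollnik potential is infinitesimally form-bounded w.r.t. `-Δ`. -/
theorem rollnik_form_bound (V : EuclideanSpace ℝ (Fin 3) → ℝ) (hV : Measurable V)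
    (lam δ : ℝ) (hlam : 0 < lam) (hδ : 0 < δ)
    (hBS : (∫⁻ x, ∫⁻ y, ENNReal.ofReal
        (|V x| * |V y| * Real.exp (-2 * Real.sqrt lam * ‖x - y‖) / ‖x - y‖ ^ 2))
      ≤ ENNReal.ofReal ((4 * π) ^ 2 * δ ^ 2)) :
    ∀ φ : EuclideanSpace ℝ (Fin 3) → ℂ, ContDiff ℝ (⊤ : ℕ∞) φ → HasCompactSupport φ →
      |∫ x, V x * ‖φ x‖ ^ 2| ≤
        δ * ((∫ x, ‖fderiv ℝ φ x‖ ^ 2) + lam * ∫ x, ‖φ x‖ ^ 2) := by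
  intro φ hφ hc
  have hφm := hφ.continuous.measurable
  have hq1 := integral_nonneg (μ := (volume : Measure E3)) (f := fun x => ‖fderiv ℝ φ x‖ ^ 2) fun x => sq_nonneg ‖fderiv ℝ φ x‖
  have hq2 := integral_nonneg (μ := (volume : Measure E3)) (f := fun x => ‖φ x‖ ^ 2) fun x => sq_nonneg ‖φ x‖
  rw [← norm_eq_abs]
  refine (norm_integral_le_lintegral_norm _).trans (ENNReal.toReal_le_of_le_ofReal (by positivity) ?_)
  have hW0 : ∀ (n : ℕ) x, 0 ≤ min |V x| (n : ℝ) := fun n x => le_min (abs_nonneg _) (Nat.cast_nonneg n)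
  have hT : Tendsto (fun n : ℕ => ∫⁻ x, ENNReal.ofReal (min |V x| n * ‖φ x‖ ^ 2)) atTop
      (𝓝 (∫⁻ x, ENNReal.ofReal ‖V x * ‖φ x‖ ^ 2‖)) := by
    refine lintegral_tendsto_of_tendsto_of_monotone (fun n => ?_) (ae_of_all _ fun x => ?_)
      (ae_of_all _ fun x => ?_)
    · exact Measurable.aemeasurable (by fun_prop)
    · intro n m hnm
      refine ENNReal.ofReal_le_ofReal ?_
      have : (n : ℝ) ≤ m := by exact_mod_cast hnm
      gcongr
    · refine tendsto_const_nhds.congr' ?_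
      obtain ⟨N, hN⟩ := exists_nat_ge |V x|
      filter_upwards [eventually_ge_atTop N] with n hn
      have : (N : ℝ) ≤ n := by exact_mod_cast hn
      rw [min_eq_left (hN.trans this), norm_mul, norm_eq_abs, norm_eq_abs, abs_of_nonneg (sq_nonneg ‖φ x‖)]
  refine le_of_tendsto hT (Eventually.of_forall fun n => ?_)
  have i1 : Integrable fun x => min |V x| (n : ℝ) * ‖φ x‖ ^ 2 :=
    W_int (by fun_prop) (M := n) (fun x => by rw [abs_of_nonneg (hW0 n x)]; exact min_le_right _ _)
      (by have := hφ.continuous; fun_prop) (hc.norm.comp_left (g := fun t : ℝ => t ^ 2) (by simp))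
  rw [← ofReal_integral_eq_lintegral_ofReal i1 (ae_of_all _ fun x => mul_nonneg (hW0 n x) (sq_nonneg _))]
  exact ENNReal.ofReal_le_ofReal (lem8 V hV lam δ hlam hδ hBS φ hφ hc n)
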